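/- Let (z, ρ) be a solution of the meridian-plane equations of motion starting from rest, ż(0) = ρ̇(0) = 0, which crosses the equatorial plane perpendicularly at some time t₁ > 0, i.e. z(t₁) = 0 and ρ̇(t₁) = 0. Then the orbit is periodic with period 4t₁ and symmetric with respect to the equatorial plane: z(t + 4t₁) = z(t), ρ(t + 4t₁) = ρ(t), z(t + 2t₁) = −z(t), and ρ(t + 2t₁) = ρ(t) for all real t; in particular z(2t₁) = −z(0) and ρ(2t₁) = ρ(0). -/

import Mathlib

/-- Right-hand side of the `z` equation of motion in the meridian plane. -/
noncomputable def fZ (z ρ : ℝ) : ℝ :=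
  -3 * z * ρ * (1 / ρ - ρ / (z ^ 2 + ρ ^ 2) ^ ((3 : ℝ) / 2)) / (z ^ 2 + ρ ^ 2) ^ ((5 : ℝ) / 2)

/-- Right-hand side of the `ρ` equation of motion in the meridian plane. -/
noncomputable def gR (z ρ : ℝ) : ℝ :=
  (1 / ρ ^ 2 - 3 * ρ ^ 2 / (z ^ 2 + ρ ^ 2) ^ ((5 : ℝ) / 2)
      + 1 / (z ^ 2 + ρ ^ 2) ^ ((3 : ℝ) / 2))
    * (1 / ρ - ρ / (z ^ 2 + ρ ^ 2) ^ ((3 : ℝ) / 2))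

/-- `(z, ρ)` is a solution of the meridian-plane equations of motion:
twice continuously differentiable, `ρ > 0` everywhere, and
`z̈ = fZ (z, ρ)`, `ρ̈ = gR (z, ρ)`. -/
def IsSolution (z ρ : ℝ → ℝ) : Prop :=
  ContDiff ℝ 2 z ∧ ContDiff ℝ 2 ρ ∧ (∀ t, 0 < ρ t) ∧
    (∀ t, deriv (deriv z) t = fZ (z t) (ρ t)) ∧
    (∀ t, deriv (deriv ρ) t = gR (z t) (ρ t))

open Set Filter Topology in
/-- Two global integral curves of a vector field which is `C¹` along one of them coincide
as soon as they agree at one time. -/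
theorem integralCurve_unique_of_contDiffAt {E : Type*} [NormedAddCommGroup E] [NormedSpace ℝ E]
    {v : E → E} {f g : ℝ → E} (hv : ∀ t, ContDiffAt ℝ 1 v (f t))
    (hf : ∀ t, HasDerivAt f (v (f t)) t) (hg : ∀ t, HasDerivAt g (v (g t)) t)
    {t₀ : ℝ} (heq : f t₀ = g t₀) : f = g := by
  have hfc : Continuous f := continuous_iff_continuousAt.2 fun t => (hf t).continuousAt
  have hgc : Continuous g := continuous_iff_continuousAt.2 fun t => (hg t).continuousAt
  have hopen : IsOpen {t | f t = g t} := by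
    refine isOpen_iff_mem_nhds.2 fun t (ht : f t = g t) => ?_
    obtain ⟨K, s, hs, hK⟩ := (hv t).exists_lipschitzOnWith
    have hfs : ∀ᶠ u in 𝓝 t, f u ∈ s := (hf t).continuousAt.eventually_mem hs
    have hgs : ∀ᶠ u in 𝓝 t, g u ∈ s := (hg t).continuousAt.eventually_mem (ht ▸ hs)
    exact ODE_solution_unique_of_eventually (v := fun _ => v) (s := fun _ => s)
      (Eventually.of_forall fun _ => hK)
      (hfs.mono fun u hu => ⟨hf u, hu⟩) (hgs.mono fun u hu => ⟨hg u, hu⟩) ht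
  have huniv : {t | f t = g t} = univ :=
    IsClopen.eq_univ ⟨isClosed_eq hfc hgc, hopen⟩ ⟨t₀, heq⟩
  exact funext fun t => huniv.ge (mem_univ t)

/-- The first-order vector field on phase space `((z, ρ), (ż, ρ̇))`. -/
noncomputable def meridianField (p : (ℝ × ℝ) × (ℝ × ℝ)) : (ℝ × ℝ) × (ℝ × ℝ) :=
  (p.2, (fZ p.1.1 p.1.2, gR p.1.1 p.1.2))

theorem contDiffAt_meridianField {p : (ℝ × ℝ) × (ℝ × ℝ)} (hp : 0 < p.1.2) :
    ContDiffAt ℝ 1 meridianField p := by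
  have hz : ContDiffAt ℝ 1 (fun q : (ℝ × ℝ) × (ℝ × ℝ) => q.1.1) p := by fun_prop
  have hρ : ContDiffAt ℝ 1 (fun q : (ℝ × ℝ) × (ℝ × ℝ) => q.1.2) p := by fun_prop
  have hpos : 0 < p.1.1 ^ 2 + p.1.2 ^ 2 := by positivity
  have hrpow (a : ℝ) : ContDiffAt ℝ 1
      (fun q : (ℝ × ℝ) × (ℝ × ℝ) => (q.1.1 ^ 2 + q.1.2 ^ 2) ^ a) p :=
    ((hz.pow 2).add (hρ.pow 2)).rpow_const_of_ne hpos.ne'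
  have hne (a : ℝ) : (p.1.1 ^ 2 + p.1.2 ^ 2) ^ a ≠ 0 := (Real.rpow_pos_of_pos hpos a).ne'
  have hc : ContDiffAt ℝ 1 (fun q : (ℝ × ℝ) × (ℝ × ℝ) =>
      1 / q.1.2 - q.1.2 / (q.1.1 ^ 2 + q.1.2 ^ 2) ^ ((3 : ℝ) / 2)) p :=
    (contDiffAt_const.div hρ hp.ne').sub (hρ.div (hrpow _) (hne _))
  refine contDiffAt_snd.prodMk (ContDiffAt.prodMk ?_ ?_)
  · exact (((contDiffAt_const.mul hz).mul hρ).mul hc).div (hrpow _) (hne _)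
  · exact (((contDiffAt_const.div (hρ.pow 2) (pow_ne_zero 2 hp.ne')).sub
      ((contDiffAt_const.mul (hρ.pow 2)).div (hrpow _) (hne _))).add
      (contDiffAt_const.div (hrpow _) (hne _))).mul hc

theorem fZ_neg (z ρ : ℝ) : fZ (-z) ρ = -fZ z ρ := by
  simp only [fZ, neg_sq]; ring

theorem gR_neg (z ρ : ℝ) : gR (-z) ρ = gR z ρ := by
  simp only [gR, neg_sq]

namespace IsSolution

variable {z ρ : ℝ → ℝ}

theorem hasDerivAt_phase (h : IsSolution z ρ) (t : ℝ) :
    HasDerivAt (fun s => ((z s, ρ s), (deriv z s, deriv ρ s)))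
      (meridianField ((z t, ρ t), (deriv z t, deriv ρ t))) t := by
  obtain ⟨hz, hρ, -, hz', hρ'⟩ := h
  have dz : Differentiable ℝ (deriv z) :=
    (hz.deriv' (n := 1)).differentiable one_ne_zero
  have dρ : Differentiable ℝ (deriv ρ) :=
    (hρ.deriv' (n := 1)).differentiable one_ne_zero
  refine ((hz.differentiable two_ne_zero t).hasDerivAt.prodMk
    (hρ.differentiable two_ne_zero t).hasDerivAt).prodMk (HasDerivAt.prodMk ?_ ?_)
  · exact hz' t ▸ (dz t).hasDerivAt
  · exact hρ' t ▸ (dρ t).hasDerivAt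

/-- Solutions are determined by their initial data. -/
theorem eq_of_initial_eq {w σ : ℝ → ℝ} (h : IsSolution z ρ) (h' : IsSolution w σ) {t₀ : ℝ}
    (hz : z t₀ = w t₀) (hρ : ρ t₀ = σ t₀) (hdz : deriv z t₀ = deriv w t₀)
    (hdρ : deriv ρ t₀ = deriv σ t₀) (t : ℝ) : z t = w t ∧ ρ t = σ t := by
  have key := congrFun (integralCurve_unique_of_contDiffAt
    (fun t => contDiffAt_meridianField (h.2.2.1 t)) h.hasDerivAt_phase h'.hasDerivAt_phase
    (t₀ := t₀) (by rw [hz, hρ, hdz, hdρ])) t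
  exact Prod.ext_iff.1 (congrArg Prod.fst key)

/-- Time reversal about `c / 2`. -/
theorem comp_const_sub (h : IsSolution z ρ) (c : ℝ) :
    IsSolution (fun t => z (c - t)) (fun t => ρ (c - t)) := by
  obtain ⟨hz, hρ, hpos, hz', hρ'⟩ := h
  have key (u : ℝ → ℝ) (t : ℝ) :
      deriv (deriv fun t => u (c - t)) t = deriv (deriv u) (c - t) := by
    have : (deriv fun t => u (c - t)) = fun t => -deriv u (c - t) :=
      funext fun t => deriv_comp_const_sub u c t
    rw [this, deriv.fun_neg, deriv_comp_const_sub, neg_neg]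
  refine ⟨hz.comp (contDiff_const.sub contDiff_id), hρ.comp (contDiff_const.sub contDiff_id),
    fun t => hpos _, fun t => ?_, fun t => ?_⟩
  · rw [key, hz']
  · rw [key, hρ']

/-- Reflection in the equatorial plane. -/
theorem neg (h : IsSolution z ρ) : IsSolution (fun t => -z t) ρ := by
  obtain ⟨hz, hρ, hpos, hz', hρ'⟩ := h
  refine ⟨hz.neg, hρ, hpos, fun t => ?_, fun t => ?_⟩
  · have : (deriv fun t => -z t) = fun t => -deriv z t := funext fun t => deriv.fun_neg
    rw [this, deriv.fun_neg, hz', fZ_neg]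
  · rw [hρ', gR_neg]

/-- A solution at rest at time `0` is even in time. -/
theorem even_of_rest (h : IsSolution z ρ) (hz : deriv z 0 = 0) (hρ : deriv ρ 0 = 0) (t : ℝ) :
    z (-t) = z t ∧ ρ (-t) = ρ t := by
  have key := h.eq_of_initial_eq (h.comp_const_sub 0) (t₀ := 0) (by simp) (by simp)
    (by rw [deriv_comp_const_sub]; simp [hz]) (by rw [deriv_comp_const_sub]; simp [hρ]) t
  simpa [eq_comm] using key

/-- A solution crossing the equatorial plane perpendicularly at time `τ` is carried to itself
by reflecting both time about `τ` and space in the equatorial plane. -/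
theorem reflect_of_perpendicular (h : IsSolution z ρ) {τ : ℝ} (hz : z τ = 0)
    (hρ : deriv ρ τ = 0) (t : ℝ) : z (2 * τ - t) = -z t ∧ ρ (2 * τ - t) = ρ t := by
  have hτ : 2 * τ - τ = τ := by ring
  have hd : deriv z τ = deriv (fun s => -z (2 * τ - s)) τ := by
    rw [deriv.fun_neg, deriv_comp_const_sub, hτ, neg_neg]
  obtain ⟨h₁, h₂⟩ := h.eq_of_initial_eq (h.comp_const_sub (2 * τ)).neg (t₀ := τ)
    (by simp [hτ, hz]) (by simp [hτ]) hd (by rw [deriv_comp_const_sub, hτ, hρ, neg_zero]) t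
  exact ⟨by linarith, h₂.symm⟩

end IsSolution


/-- A solution starting from rest that crosses the equatorial plane perpendicularly
at some time `t₁ > 0` is periodic with period `4t₁` and symmetric with respect to
the equatorial plane. -/
theorem perpendicular_crossing_implies_symmetric_periodic (z ρ : ℝ → ℝ)
    (hsol : IsSolution z ρ) (hz0 : deriv z 0 = 0) (hρ0 : deriv ρ 0 = 0)
    (t₁ : ℝ) (ht₁ : 0 < t₁) (hz1 : z t₁ = 0) (hρ1 : deriv ρ t₁ = 0) :
    (∀ t : ℝ, z (t + 4 * t₁) = z t ∧ ρ (t + 4 * t₁) = ρ t ∧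
        z (t + 2 * t₁) = -z t ∧ ρ (t + 2 * t₁) = ρ t) ∧
      z (2 * t₁) = -z 0 ∧ ρ (2 * t₁) = ρ 0 := by
  have half (t : ℝ) : z (t + 2 * t₁) = -z t ∧ ρ (t + 2 * t₁) = ρ t := by
    have hr := hsol.reflect_of_perpendicular hz1 hρ1 (-t)
    obtain ⟨he₁, he₂⟩ := hsol.even_of_rest hz0 hρ0 t
    rwa [he₁, he₂, sub_neg_eq_add, add_comm] at hr
  refine ⟨fun t => ?_, by simpa using half 0⟩
  obtain ⟨h₁, h₂⟩ := half t
  obtain ⟨h₃, h₄⟩ := half (t + 2 * t₁)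
  rw [show t + 2 * t₁ + 2 * t₁ = t + 4 * t₁ by ring] at h₃ h₄
  exact ⟨by rw [h₃, h₁, neg_neg], by rw [h₄, h₂], h₁, h₂⟩
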